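/- Let λ > −1/2. If 0 ≤ λ ≤ 1, then the sequences (α_{2n+1}^λ)_{n≥0} and (α_{2n}^λ)_{n≥1} are nonincreasing (strictly decreasing when 0 < λ < 1); if λ > 1 or −1/2 < λ < 0, then both sequences are strictly increasing. -/

import Mathlib

open Real

/-- `α_{2n+1}^λ = (2 Γ(n+3/2) Γ(n+1+λ) / ((2n+λ+1) Γ(n+1) Γ(n+λ+1/2)))^{1/2}`, `n ≥ 0`. -/
noncomputable def alphaOdd (lam : ℝ) (n : ℕ) : ℝ :=
  Real.sqrt (2 * Real.Gamma ((n : ℝ) + 3 / 2) * Real.Gamma ((n : ℝ) + 1 + lam) /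
    ((2 * (n : ℝ) + lam + 1) * Real.Gamma ((n : ℝ) + 1) * Real.Gamma ((n : ℝ) + lam + 1 / 2)))

/-- `α_{2n}^λ = (2 n! Γ(n+λ+1/2) / ((2n+λ) Γ(n+1/2) Γ(n+λ)))^{1/2}`, `n ≥ 1`. -/
noncomputable def alphaEven (lam : ℝ) (n : ℕ) : ℝ :=
  Real.sqrt (2 * (n.factorial : ℝ) * Real.Gamma ((n : ℝ) + lam + 1 / 2) /
    ((2 * (n : ℝ) + lam) * Real.Gamma ((n : ℝ) + 1 / 2) * Real.Gamma ((n : ℝ) + lam)))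

/-- `α_n^λ`, combining the two parities: `α_{2m}^λ = alphaEven λ m`, `α_{2m+1}^λ = alphaOdd λ m`. -/
noncomputable def alphaCoef (lam : ℝ) (n : ℕ) : ℝ :=
  if n % 2 = 1 then alphaOdd lam (n / 2) else alphaEven lam (n / 2)

/-- `β_λ(n) = (1 - (α_n^λ)²(1 - 1/(8n²))) n (n+2λ)`. -/
noncomputable def betaCoef (lam : ℝ) (n : ℕ) : ℝ :=
  (1 - (alphaCoef lam n) ^ 2 * (1 - 1 / (8 * (n : ℝ) ^ 2))) * ((n : ℝ) * ((n : ℝ) + 2 * lam))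

/-- The common extension of `(alphaOdd lam n) ^ 2` and `(alphaEven lam n) ^ 2` to a real argument `x`,
taken at `x = n + 1 / 2` and `x = n` respectively. -/
noncomputable def alphaSq (lam x : ℝ) : ℝ :=
  2 * Real.Gamma (x + 1) * Real.Gamma (x + lam + 1 / 2) /
    ((2 * x + lam) * Real.Gamma (x + 1 / 2) * Real.Gamma (x + lam))

theorem alphaOdd_eq_sqrt_alphaSq (lam : ℝ) (n : ℕ) :
    alphaOdd lam n = √(alphaSq lam (n + 1 / 2)) := by
  unfold alphaOdd alphaSq
  ring_nf

theorem alphaEven_eq_sqrt_alphaSq (lam : ℝ) (n : ℕ) :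
    alphaEven lam n = √(alphaSq lam n) := by
  rw [alphaEven, alphaSq, Real.Gamma_nat_eq_factorial]

theorem alphaSq_pos {lam x : ℝ} (hx : 0 < x) (hxl : 0 < x + lam) : 0 < alphaSq lam x := by
  have h₁ : 0 < 2 * x + lam := by linarith
  have h₂ := Real.Gamma_pos_of_pos (show 0 < x + 1 by linarith)
  have h₃ := Real.Gamma_pos_of_pos (show 0 < x + lam + 1 / 2 by linarith)
  have h₄ := Real.Gamma_pos_of_pos (show 0 < x + 1 / 2 by linarith)
  have h₅ := Real.Gamma_pos_of_pos hxl
  unfold alphaSq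
  positivity

theorem alphaSq_add_one_sub {lam x : ℝ} (hx : 0 < x) (hxl : 0 < x + lam) :
    alphaSq lam (x + 1) - alphaSq lam x =
      alphaSq lam x / (2 * (2 * x + 2 + lam) * (x + 1 / 2) * (x + lam)) * (lam * (lam - 1)) := by
  have h₁ : 2 * x + lam ≠ 0 := by linarith
  have h₂ : 2 * x + 2 + lam ≠ 0 := by linarith
  have h₃ : x + 1 / 2 ≠ 0 := by linarith
  have h₄ := (Real.Gamma_pos_of_pos (show 0 < x + 1 / 2 by linarith)).ne'
  have h₅ := (Real.Gamma_pos_of_pos hxl).ne'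
  have h : alphaSq lam (x + 1) = alphaSq lam x *
      ((x + 1) * (x + lam + 1 / 2) * (2 * x + lam) /
        ((2 * x + 2 + lam) * (x + 1 / 2) * (x + lam))) := by
    unfold alphaSq
    rw [show x + 1 + lam + 1 / 2 = x + lam + 1 / 2 + 1 by ring,
      show x + 1 + 1 / 2 = x + 1 / 2 + 1 by ring, show x + 1 + lam = x + lam + 1 by ring,
      show 2 * (x + 1) + lam = 2 * x + 2 + lam by ring,
      Real.Gamma_add_one (show x + 1 ≠ 0 by linarith),
      Real.Gamma_add_one (show x + lam + 1 / 2 ≠ 0 by linarith),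
      Real.Gamma_add_one h₃, Real.Gamma_add_one hxl.ne']
    generalize Real.Gamma (x + 1 / 2) = a at *
    generalize Real.Gamma (x + lam) = b at *
    rw [div_mul_div_comm, div_eq_div_iff (by simp_all [hxl.ne']) (by simp_all [hxl.ne'])]
    ring
  have key : (x + 1) * (x + lam + 1 / 2) * (2 * x + lam) /
      ((2 * x + 2 + lam) * (x + 1 / 2) * (x + lam)) =
      1 + lam * (lam - 1) / (2 * (2 * x + 2 + lam) * (x + 1 / 2) * (x + lam)) := by
    have h₆ := hxl.ne'
    have hD : (2 * x + 2 + lam) * (x + 1 / 2) * (x + lam) ≠ 0 := mul_ne_zero (mul_ne_zero h₂ h₃) h₆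
    have hD' : 2 * (2 * x + 2 + lam) * (x + 1 / 2) * (x + lam) ≠ 0 :=
      mul_ne_zero (mul_ne_zero (mul_ne_zero two_ne_zero h₂) h₃) h₆
    rw [one_add_div hD', div_eq_div_iff hD hD']
    ring
  rw [h, key]
  ring

theorem exists_pos_alphaSq_add_one_sub {lam x : ℝ} (hx : 0 < x) (hxl : 0 < x + lam) :
    ∃ c > 0, alphaSq lam (x + 1) - alphaSq lam x = c * (lam * (lam - 1)) := by
  refine ⟨_, ?_, alphaSq_add_one_sub hx hxl⟩
  have h₁ := alphaSq_pos hx hxl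
  have h₂ : 0 < 2 * x + 2 + lam := by linarith
  positivity

theorem sqrt_alphaSq_add_one_le {lam x : ℝ} (hx : 0 < x) (hxl : 0 < x + lam)
    (h : lam * (lam - 1) ≤ 0) : √(alphaSq lam (x + 1)) ≤ √(alphaSq lam x) := by
  obtain ⟨c, hc, hd⟩ := exists_pos_alphaSq_add_one_sub hx hxl
  exact Real.sqrt_le_sqrt (by nlinarith)

theorem sqrt_alphaSq_add_one_lt {lam x : ℝ} (hx : 0 < x) (hxl : 0 < x + lam)
    (h : lam * (lam - 1) < 0) : √(alphaSq lam (x + 1)) < √(alphaSq lam x) := by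
  obtain ⟨c, hc, hd⟩ := exists_pos_alphaSq_add_one_sub hx hxl
  exact Real.sqrt_lt_sqrt (alphaSq_pos (by linarith) (by linarith)).le (by nlinarith)

theorem sqrt_alphaSq_lt_add_one {lam x : ℝ} (hx : 0 < x) (hxl : 0 < x + lam)
    (h : 0 < lam * (lam - 1)) : √(alphaSq lam x) < √(alphaSq lam (x + 1)) := by
  obtain ⟨c, hc, hd⟩ := exists_pos_alphaSq_add_one_sub hx hxl
  exact Real.sqrt_lt_sqrt (alphaSq_pos hx hxl).le (by nlinarith)

/-- **Lemma 3.5 (ii).** For `λ > -1/2`: if `0 ≤ λ ≤ 1` the sequences `(α_{2n+1}^λ)_{n≥0}` and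
`(α_{2n}^λ)_{n≥1}` are nonincreasing (strictly decreasing when `0 < λ < 1`); if `λ > 1` or
`-1/2 < λ < 0`, both sequences are strictly increasing. -/
theorem alpha_monotonicity (lam : ℝ) (hlam : -1 / 2 < lam) :
    ((0 ≤ lam ∧ lam ≤ 1) →
      (∀ n : ℕ, alphaOdd lam (n + 1) ≤ alphaOdd lam n) ∧
      (∀ n : ℕ, 1 ≤ n → alphaEven lam (n + 1) ≤ alphaEven lam n)) ∧
    ((0 < lam ∧ lam < 1) →
      (∀ n : ℕ, alphaOdd lam (n + 1) < alphaOdd lam n) ∧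
      (∀ n : ℕ, 1 ≤ n → alphaEven lam (n + 1) < alphaEven lam n)) ∧
    ((1 < lam ∨ lam < 0) →
      (∀ n : ℕ, alphaOdd lam n < alphaOdd lam (n + 1)) ∧
      (∀ n : ℕ, 1 ≤ n → alphaEven lam n < alphaEven lam (n + 1))) := by
  have odd_pos (n : ℕ) : (0 : ℝ) < n + 1 / 2 ∧ 0 < (n : ℝ) + 1 / 2 + lam := by
    have : (0 : ℝ) ≤ n := n.cast_nonneg
    constructor <;> linarith
  have even_pos {n : ℕ} (hn : 1 ≤ n) : (0 : ℝ) < n ∧ 0 < (n : ℝ) + lam := by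
    have : (1 : ℝ) ≤ n := by exact_mod_cast hn
    constructor <;> linarith
  simp only [alphaOdd_eq_sqrt_alphaSq, alphaEven_eq_sqrt_alphaSq, Nat.cast_add, Nat.cast_one,
    add_right_comm _ (1 : ℝ) (1 / 2)]
  refine ⟨fun h ↦ ?_, fun h ↦ ?_, fun h ↦ ?_⟩
  · have hl : lam * (lam - 1) ≤ 0 := by nlinarith
    exact ⟨fun n ↦ sqrt_alphaSq_add_one_le (odd_pos n).1 (odd_pos n).2 hl,
      fun n hn ↦ sqrt_alphaSq_add_one_le (even_pos hn).1 (even_pos hn).2 hl⟩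
  · have hl : lam * (lam - 1) < 0 := by nlinarith
    exact ⟨fun n ↦ sqrt_alphaSq_add_one_lt (odd_pos n).1 (odd_pos n).2 hl,
      fun n hn ↦ sqrt_alphaSq_add_one_lt (even_pos hn).1 (even_pos hn).2 hl⟩
  · have hl : 0 < lam * (lam - 1) := by rcases h with h | h <;> nlinarith
    exact ⟨fun n ↦ sqrt_alphaSq_lt_add_one (odd_pos n).1 (odd_pos n).2 hl,
      fun n hn ↦ sqrt_alphaSq_lt_add_one (even_pos hn).1 (even_pos hn).2 hl⟩
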